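/- Cardinality reduction (Appendix C): Let X, Y, Z, U, V be random variables on finite alphabets 𝒳, 𝒴, 𝒵, 𝒰, 𝒱 whose joint pmf has the form P_{X,Y,Z} P_{V|X} P_{U|V}, i.e., U − V − X − (Y,Z) is a Markov chain. Then there exist random variables U', V' on finite alphabets with |𝒰'| ≤ |𝒳| + 4 and |𝒱'| ≤ (|𝒳|+4)(|𝒳|+2), jointly distributed with (X,Y,Z) such that U' − V' − X − (Y,Z) is a Markov chain, the marginal law of (X,Y,Z) is unchanged, and H(X,Y|V') = H(X,Y|V), H(Y|V') = H(Y|V), H(Z|V') = H(Z|V), H(Y|U') = H(Y|U), H(Z|U') = H(Z|U). Consequently the four quantities I(Y;U), I(X;V|Y), I(X;V,Y) − I(X;Y|U) + I(X;Z|U) and I(V;Y|U) − I(V;Z|U) are preserved. -/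

import Mathlib

open Finset Real

/- Probability mass of the event `X = x` under the pmf `μ` on a finite sample space. -/
open Classical in
noncomputable def pmass {Ω α : Type*} [Fintype Ω] (μ : Ω → ℝ) (X : Ω → α) (x : α) : ℝ :=
  ∑ ω, if X ω = x then μ ω else 0

/-- Shannon entropy (in bits) of the random variable `X` under the pmf `μ`. -/
noncomputable def ent {Ω α : Type*} [Fintype Ω] [Fintype α] (μ : Ω → ℝ) (X : Ω → α) : ℝ :=
  ∑ x, -(pmass μ X x * Real.logb 2 (pmass μ X x))

/-- Conditional Shannon entropy `H(X | Y)` (in bits). -/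
noncomputable def condEnt {Ω α β : Type*} [Fintype Ω] [Fintype α] [Fintype β]
    (μ : Ω → ℝ) (X : Ω → α) (Y : Ω → β) : ℝ :=
  ent μ (fun ω => (X ω, Y ω)) - ent μ Y

/-- Mutual information `I(X;Y)` (in bits). -/
noncomputable def mutInf {Ω α β : Type*} [Fintype Ω] [Fintype α] [Fintype β]
    (μ : Ω → ℝ) (X : Ω → α) (Y : Ω → β) : ℝ :=
  ent μ X + ent μ Y - ent μ (fun ω => (X ω, Y ω))

/-- Conditional mutual information `I(X;Y|Z)` (in bits). -/
noncomputable def condMutInf {Ω α β γ : Type*} [Fintype Ω] [Fintype α] [Fintype β] [Fintype γ]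
    (μ : Ω → ℝ) (X : Ω → α) (Y : Ω → β) (Z : Ω → γ) : ℝ :=
  ent μ (fun ω => (X ω, Z ω)) + ent μ (fun ω => (Y ω, Z ω))
    - ent μ (fun ω => (X ω, Y ω, Z ω)) - ent μ Z

/- Probability of the event `A` under the pmf `μ`. -/
open Classical in
noncomputable def prob {Ω : Type*} [Fintype Ω] (μ : Ω → ℝ) (A : Ω → Prop) : ℝ :=
  ∑ ω, if A ω then μ ω else 0

/-- `μ` is a probability mass function on the finite set `Ω`. -/
def IsPMF {Ω : Type*} [Fintype Ω] (μ : Ω → ℝ) : Prop :=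
  (∀ ω, 0 ≤ μ ω) ∧ ∑ ω, μ ω = 1

/-- Binary entropy function (bits). -/
noncomputable def binH (t : ℝ) : ℝ :=
  -(t * Real.logb 2 t) - (1 - t) * Real.logb 2 (1 - t)
/-- Joint distribution of `(U,V,X,Y,Z)` of the form `P_{X,Y,Z} P_{V|X} P_{U|V}`,
so that `U − V − X − (Y,Z)` is a Markov chain. -/
noncomputable def mkJoint {𝒰 𝒱 𝒳 𝒴 𝒵 : Type}
    (PXYZ : 𝒳 × 𝒴 × 𝒵 → ℝ) (PVX : 𝒳 → 𝒱 → ℝ) (PUV : 𝒱 → 𝒰 → ℝ) :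
    𝒰 × 𝒱 × 𝒳 × 𝒴 × 𝒵 → ℝ :=
  fun ω => PXYZ (ω.2.2.1, ω.2.2.2.1, ω.2.2.2.2) * PVX ω.2.2.1 ω.2.1 * PUV ω.2.1 ω.1

section FenchelEggleston

variable {E : Type*} [NormedAddCommGroup E] [NormedSpace ℝ E]

/-- `x` is a convex combination of at most `n` points of `S`. -/
def IsConvexCombOf (n : ℕ) (S : Set E) (x : E) : Prop :=
  ∃ (w : Fin n → ℝ) (z : Fin n → E), (∀ i, 0 ≤ w i) ∧ ∑ i, w i = 1 ∧ (∀ i, z i ∈ S) ∧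
    ∑ i, w i • z i = x

lemma IsConvexCombOf.of_card_le {ι : Type*} [Fintype ι] {n : ℕ} (hn : Fintype.card ι ≤ n)
    {S : Set E} {x : E} (w : ι → ℝ) (z : ι → E) (hw : ∀ i, 0 ≤ w i) (hw1 : ∑ i, w i = 1)
    (hz : ∀ i, z i ∈ S) (hx : ∑ i, w i • z i = x) : IsConvexCombOf n S x := by
  have hne : Nonempty ι := by
    by_contra h
    rw [not_nonempty_iff] at h
    simp at hw1
  obtain ⟨i₀⟩ := hne
  obtain ⟨e⟩ : Nonempty (ι ↪ Fin n) := by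
    rw [Function.Embedding.nonempty_iff_card_le]; simpa using hn
  have hext : ∀ i, Function.extend e w 0 (e i) = w i := fun i => e.injective.extend_apply _ _ _
  have hextz : ∀ i, Function.extend e z (fun _ => z i₀) (e i) = z i :=
    fun i => e.injective.extend_apply _ _ _
  have h0 : ∀ k ∉ Set.range e, Function.extend e w 0 k = 0 := fun k hk =>
    Function.extend_apply' _ _ _ (by simpa using hk)
  refine ⟨Function.extend e w 0, Function.extend e z (fun _ => z i₀), ?_, ?_, ?_, ?_⟩
  · intro k
    by_cases hk : k ∈ Set.range e
    · obtain ⟨i, rfl⟩ := hk; rw [hext]; exact hw i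
    · rw [h0 k hk]
  · rw [← hw1]
    exact (Fintype.sum_of_injective e e.injective _ _ h0 fun i => (hext i).symm).symm
  · intro k
    by_cases hk : k ∈ Set.range e
    · obtain ⟨i, rfl⟩ := hk; rw [hextz]; exact hz i
    · rw [Function.extend_apply' _ _ _ (by simpa using hk)]; exact hz i₀
  · rw [← hx]
    refine (Fintype.sum_of_injective e e.injective _ _ (fun k hk => ?_) fun i => ?_).symm
    · rw [h0 k hk, zero_smul]
    · rw [hext, hextz]

/-- Exchange step of the Fenchel–Eggleston theorem: a connected set spanned by a simplex with `x`
in its interior contains a point that can replace two vertices. -/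
lemma IsConvexCombOf.of_basis [FiniteDimensional ℝ E] {ι : Type*} [Fintype ι] {n : ℕ}
    (hn : Fintype.card ι = n + 1) (hn1 : 1 ≤ n) {S : Set E} (hS : IsPreconnected S)
    (φ : E →ₗ[ℝ] ℝ) (hφ : ∀ s ∈ S, φ s = 1) {x : E} (b : Module.Basis ι ℝ E) (w : ι → ℝ)
    (hw : ∀ i, 0 < w i) (hw1 : ∑ i, w i = 1) (hb : ∀ i, b i ∈ S)
    (hx : ∑ i, w i • b i = x) : IsConvexCombOf n S x := by
  classical
  obtain ⟨i₀, i₁, h01⟩ := Fintype.exists_pair_of_one_lt_card (show 1 < Fintype.card ι by omega)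
  have hne : (univ.erase i₀).Nonempty := ⟨i₁, by simp [h01.symm]⟩
  let f : ι → E → ℝ := fun k s => b.repr s k / w k
  have hf : ∀ k, Continuous (f k) := fun k =>
    (LinearMap.continuous_of_finiteDimensional (b.coord k)).div_const _
  let g : E → ℝ := fun s => f i₀ s - (univ.erase i₀).sup' hne fun k => f k s
  have hg : Continuous g := (hf i₀).sub (Continuous.finset_sup'_apply hne fun k _ => hf k)
  have hg0 : 0 ≤ g (b i₀) := by
    have : (univ.erase i₀).sup' hne (fun k => f k (b i₀)) ≤ 0 := by
      refine Finset.sup'_le _ _ fun k hk => ?_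
      have hk' : i₀ ≠ k := fun h => by simp [h] at hk
      simp [f, hk']
    have h2 : 0 ≤ f i₀ (b i₀) := by simp [f, (hw i₀).le]
    simp only [g]; linarith
  have hg1 : g (b i₁) ≤ 0 := by
    have : f i₁ (b i₁) ≤ (univ.erase i₀).sup' hne (fun k => f k (b i₁)) :=
      Finset.le_sup' (fun k => f k (b i₁)) (by simp [h01.symm])
    have h2 : 0 ≤ f i₁ (b i₁) := by simp [f, (hw i₁).le]
    have h3 : f i₀ (b i₁) = 0 := by simp [f, h01.symm]
    simp only [g]; linarith
  obtain ⟨s, hs, hgs⟩ := hS.intermediate_value (hb i₁) (hb i₀) hg.continuousOn ⟨hg1, hg0⟩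
  obtain ⟨k, hk, hks⟩ := Finset.exists_mem_eq_sup' hne (fun k => f k s)
  have hk0 : k ≠ i₀ := (Finset.mem_erase.1 hk).1
  set M := f i₀ s with hM
  have hMs : (univ.erase i₀).sup' hne (fun k => f k s) = M := by simp only [g] at hgs; linarith
  have hkM : f k s = M := by rw [← hks, hMs]
  have hle : ∀ j, f j s ≤ M := by
    intro j
    by_cases hj : j = i₀
    · rw [hj]
    · rw [← hMs]; exact Finset.le_sup' (fun k => f k s) (by simp [hj])
  have hsum : ∑ j, b.repr s j • b j = s := b.sum_repr s
  have ht1 : ∑ j, b.repr s j = 1 := by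
    have := congrArg φ hsum
    rw [map_sum, hφ s hs] at this
    rw [← this]
    exact Finset.sum_congr rfl fun j _ => by rw [map_smul, hφ _ (hb j), smul_eq_mul, mul_one]
  have htf : ∀ j, b.repr s j = f j s * w j := fun j => by
    simp only [f]; rw [div_mul_cancel₀ _ (hw j).ne']
  have hM1 : 1 ≤ M := by
    calc (1 : ℝ) = ∑ j, f j s * w j := by rw [← ht1]; exact Finset.sum_congr rfl fun j _ => htf j
      _ ≤ ∑ j, M * w j := Finset.sum_le_sum fun j _ =>
          mul_le_mul_of_nonneg_right (hle j) (hw j).le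
      _ = M := by rw [← Finset.mul_sum, hw1, mul_one]
  have hM0 : 0 < M := by linarith
  let w' : ι → ℝ := fun j => if j = k then 1 / M else (M - f j s) * w j / M
  let z' : ι → E := fun j => if j = k then s else b j
  have hc0 : ∀ j, f j s = M → (M - f j s) * w j / M = 0 := fun j hj => by simp [hj]
  have hz' : ∀ j, z' j ∈ S := fun j => by
    simp only [z']; split_ifs
    exacts [hs, hb j]
  have hsplit : ∀ j, w' j • z' j =
      ((M - f j s) * w j / M) • b j + if k = j then (1 / M) • s else 0 := fun j => by
    by_cases hj : j = k
    · subst hj; simp [w', z', hkM]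
    · simp [w', z', hj, Ne.symm hj]
  have hcb : ∀ j, ((M - f j s) * w j / M) • b j = w j • b j - (1 / M) • (b.repr s j • b j) :=
    fun j => by
      rw [smul_smul, ← sub_smul, htf j]
      congr 1
      field_simp
  have hxsum : ∑ j : {j // j ≠ i₀}, w' j • z' j = x := by
    rw [← Finset.sum_subtype (univ.erase i₀) (by simp) fun j => w' j • z' j,
      Finset.sum_congr rfl fun j _ => hsplit j, Finset.sum_add_distrib, Finset.sum_ite_eq,
      if_pos hk, Finset.sum_erase _ (by rw [hc0 i₀ rfl, zero_smul]),
      Finset.sum_congr rfl fun j _ => hcb j, Finset.sum_sub_distrib, ← Finset.smul_sum, hsum, hx,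
      sub_add_cancel]
  have hφx : φ x = 1 := by
    rw [← hx, map_sum, ← hw1]
    exact Finset.sum_congr rfl fun j _ => by rw [map_smul, hφ _ (hb j), smul_eq_mul, mul_one]
  refine .of_card_le (ι := {j // j ≠ i₀}) ?_ (fun j => w' j) (fun j => z' j) (fun j => ?_) ?_
    (fun j => hz' j) hxsum
  · rw [Fintype.card_subtype_compl, hn]; simp
  · simp only [w']
    split_ifs
    · positivity
    · exact div_nonneg (mul_nonneg (sub_nonneg.2 (hle _)) (hw _).le) hM0.le
  · rw [← hφx, ← hxsum, map_sum]
    exact Finset.sum_congr rfl fun j _ => by rw [map_smul, hφ _ (hz' j), smul_eq_mul, mul_one]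

/-- Fenchel–Eggleston: in a hyperplane `φ = 1` of an `(n+1)`-dimensional space, every point of the
convex hull of a connected set is a convex combination of at most `n` of its points. -/
lemma IsPreconnected.isConvexCombOf [FiniteDimensional ℝ E] {n : ℕ}
    (hn : Module.finrank ℝ E = n + 1) (hn1 : 1 ≤ n) {S : Set E} (hS : IsPreconnected S)
    (φ : E →ₗ[ℝ] ℝ) (hφ : ∀ s ∈ S, φ s = 1) {x : E} (hx : x ∈ convexHull ℝ S) :
    IsConvexCombOf n S x := by
  obtain ⟨ι, _, z, w, hz, hAI, hw, hw1, hsum⟩ := eq_pos_convex_span_of_mem_convexHull hx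
  have hzS : ∀ i, z i ∈ S := fun i => hz ⟨i, rfl⟩
  have hLI : LinearIndependent ℝ z := by
    rw [Fintype.linearIndependent_iff]
    intro c hc i
    refine affineIndependent_iff.1 hAI univ c ?_ hc i (mem_univ i)
    have := congrArg φ hc
    rw [map_sum, map_zero] at this
    rw [← this]
    exact Finset.sum_congr rfl fun j _ => by rw [map_smul, hφ _ (hzS j), smul_eq_mul, mul_one]
  rcases (hn ▸ hLI.fintype_card_le_finrank).lt_or_eq with h | h
  · exact .of_card_le (by omega) w z (fun i => (hw i).le) hw1 hzS hsum
  · have : Nonempty ι := Fintype.card_pos_iff.1 (by omega)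
    let b := basisOfLinearIndependentOfCardEqFinrank hLI (h.trans hn.symm)
    have hbz : ∀ i, b i = z i := fun i => by
      simp [b, coe_basisOfLinearIndependentOfCardEqFinrank]
    exact .of_basis h hn1 hS φ hφ b w hw hw1 (fun i => hbz i ▸ hzS i)
      (by simpa only [hbz] using hsum)

end FenchelEggleston

lemma Convex.exists_smul_eq_sum {E ι : Type*} [AddCommGroup E] [Module ℝ E] [Fintype ι]
    {C : Set E} (hC : Convex ℝ C) (hne : C.Nonempty) (w : ι → ℝ) (hw : ∀ i, 0 ≤ w i) (z : ι → E)
    (hz : ∀ i, z i ∈ C) : ∃ m ∈ C, ∑ i, w i • z i = (∑ i, w i) • m := by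
  rcases (Finset.sum_nonneg fun i _ => hw i : 0 ≤ ∑ i, w i).eq_or_lt with h | h
  · obtain ⟨m, hm⟩ := hne
    refine ⟨m, hm, ?_⟩
    have h0 : ∀ i, w i = 0 := fun i =>
      (Finset.sum_eq_zero_iff_of_nonneg fun i _ => hw i).1 h.symm i (mem_univ i)
    simp [h0]
  · refine ⟨univ.centerMass w z, hC.centerMass_mem (fun i _ => hw i) h fun i _ => hz i, ?_⟩
    rw [Finset.centerMass, smul_inv_smul₀ h.ne']

/-- Support lemma applied twice: the measures `r v` (the joint law of `X` and `V`) and the channel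
`k` from `V` to `U` can be replaced by few measures, indexed by pairs whose first component plays
the role of `U`. -/
lemma exists_support_reduction {α 𝒰 𝒱 : Type*} [Fintype α] [Fintype 𝒰] [Fintype 𝒱]
    (h₁ h₂ h₃ : (α → ℝ) → ℝ) (hc₁ : Continuous h₁) (hc₂ : Continuous h₂) (hc₃ : Continuous h₃)
    (hh₁ : ∀ (c : ℝ) q, h₁ (c • q) = c * h₁ q) (hh₂ : ∀ (c : ℝ) q, h₂ (c • q) = c * h₂ q)
    (hh₃ : ∀ (c : ℝ) q, h₃ (c • q) = c * h₃ q)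
    (r : 𝒱 → α → ℝ) (hr : ∀ v x, 0 ≤ r v x) (p : α → ℝ) (hp : IsPMF p) (hrp : ∑ v, r v = p)
    (k : 𝒱 → 𝒰 → ℝ) (hk : ∀ v, IsPMF (k v)) :
    ∃ r' : Fin (Fintype.card α + 4) → Fin (Fintype.card α + 2) → α → ℝ,
      (∀ i j x, 0 ≤ r' i j x) ∧ ∑ i, ∑ j, r' i j = p ∧
      ∑ i, ∑ j, h₁ (r' i j) = ∑ v, h₁ (r v) ∧
      ∑ i, ∑ j, h₂ (r' i j) = ∑ v, h₂ (r v) ∧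
      ∑ i, ∑ j, h₃ (r' i j) = ∑ v, h₃ (r v) ∧
      ∑ i, h₂ (∑ j, r' i j) = ∑ u, h₂ (∑ v, k v u • r v) ∧
      ∑ i, h₃ (∑ j, r' i j) = ∑ u, h₃ (∑ v, k v u • r v) := by
  classical
  have hcα : 0 < Fintype.card α := by
    rw [Fintype.card_pos_iff]
    by_contra h
    rw [not_nonempty_iff] at h
    simpa using hp.2
  let Δ := stdSimplex ℝ α
  have hΔne : Δ.Nonempty := ⟨p, hp.1, hp.2⟩
  let F : (α → ℝ) → (α → ℝ) × ℝ × ℝ × ℝ := fun q => (q, h₁ q, h₂ q, h₃ q)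
  have hF : Continuous F := by fun_prop
  let G : (α → ℝ) × ℝ × ℝ × ℝ → ((α → ℝ) × ℝ × ℝ × ℝ) × ℝ × ℝ := fun m => (m, h₂ m.1, h₃ m.1)
  have hG : Continuous G := by fun_prop
  let φ : (α → ℝ) × ℝ × ℝ × ℝ →ₗ[ℝ] ℝ := (∑ x, LinearMap.proj x) ∘ₗ LinearMap.fst ℝ _ _
  have hφ : ∀ m, φ m = ∑ x, m.1 x := fun m => by simp [φ]
  let C := convexHull ℝ (F '' Δ)
  have hCne : C.Nonempty := (hΔne.image F).convexHull
  have hφC : ∀ m ∈ C, φ m = 1 := by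
    intro m hm
    have hconv : Convex ℝ {m | φ m = 1} := convex_hyperplane φ.isLinear 1
    refine convexHull_min ?_ hconv hm
    rintro _ ⟨q, hq, rfl⟩
    rw [Set.mem_ofPred_eq, hφ]
    exact hq.2
  have hq : ∀ v, ∃ q ∈ Δ, r v = (∑ x, r v x) • q := by
    intro v
    obtain ⟨q, hq, h⟩ := (convex_stdSimplex ℝ α).exists_smul_eq_sum hΔne (r v) (hr v)
      (fun x => Pi.single x 1) (fun x => single_mem_stdSimplex ℝ x)
    refine ⟨q, hq, ?_⟩
    rw [← h]
    ext y
    simp [Finset.sum_apply, Pi.single_apply]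
  choose q hqΔ hrq using hq
  let P : 𝒱 → ℝ := fun v => ∑ x, r v x
  have hP : ∀ v, 0 ≤ P v := fun v => Finset.sum_nonneg fun x _ => hr v x
  have hrq' : ∀ v, P v • q v = r v := fun v => (hrq v).symm
  have hP1 : ∑ v, P v = 1 := by
    rw [← hp.2, ← hrp, Finset.sum_comm]
    simp [Finset.sum_apply]
  have hm : ∀ u, ∃ m ∈ C, ∑ v, (P v * k v u) • F (q v) = (∑ v, P v * k v u) • m := fun u =>
    (convex_convexHull ℝ _).exists_smul_eq_sum hCne _ (fun v => mul_nonneg (hP v) ((hk v).1 u)) _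
      (fun v => subset_convexHull ℝ _ ⟨q v, hqΔ v, rfl⟩)
  choose m hmC hm using hm
  let Q : 𝒰 → ℝ := fun u => ∑ v, P v * k v u
  have hQ : ∀ u, 0 ≤ Q u := fun u => Finset.sum_nonneg fun v _ => mul_nonneg (hP v) ((hk v).1 u)
  have hQ1 : ∑ u, Q u = 1 := by
    rw [← hP1, Finset.sum_comm]
    exact Finset.sum_congr rfl fun v _ => by rw [← Finset.mul_sum, (hk v).2, mul_one]
  have hx : ∑ u, Q u • G (m u) ∈ convexHull ℝ (G '' C) :=
    (convex_convexHull ℝ _).sum_mem (fun u _ => hQ u) hQ1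
      fun u _ => subset_convexHull ℝ _ ⟨m u, hmC u, rfl⟩
  obtain ⟨lam, z, hlam, hlam1, hz, hlz⟩ := IsPreconnected.isConvexCombOf
    (n := Fintype.card α + 4) (by simp [Module.finrank_prod]) (by omega)
    ((convex_convexHull ℝ (F '' Δ)).isPreconnected.image G hG.continuousOn)
    (φ ∘ₗ LinearMap.fst ℝ _ _) (by rintro _ ⟨m, hm, rfl⟩; exact hφC m hm) hx
  choose m' hm'C hm'z using hz
  have hinner : ∀ i, IsConvexCombOf (Fintype.card α + 2) (F '' Δ) (m' i) := fun i =>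
    IsPreconnected.isConvexCombOf (by simp [Module.finrank_prod]) (by omega)
      ((convex_stdSimplex ℝ α).isPreconnected.image F hF.continuousOn) φ
      (fun s hs => hφC s (subset_convexHull ℝ _ hs)) (hm'C i)
  choose mu y hmu hmu1 hy hmy using hinner
  choose q' hq'Δ hq'y using hy
  have hsumm : ∑ u, Q u • m u = ∑ v, P v • F (q v) := by
    simp only [Q, ← hm]
    rw [Finset.sum_comm]
    exact Finset.sum_congr rfl fun v _ => by
      rw [← Finset.sum_smul, ← Finset.mul_sum, (hk v).2, mul_one]
  have hG' : ∑ i, lam i • G (m' i) = ∑ u, Q u • G (m u) := by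
    rw [← hlz]; exact Finset.sum_congr rfl fun i _ => by rw [hm'z]
  have hm' : ∀ i, ∑ j, mu i j • F (q' i j) = m' i := fun i => by
    rw [← hmy]; exact Finset.sum_congr rfl fun j _ => by rw [hq'y]
  have hV : ∑ i, lam i • ∑ j, mu i j • F (q' i j) = ∑ v, P v • F (q v) := by
    have := congrArg Prod.fst hG'
    simp only [Prod.fst_sum, Prod.smul_fst, G] at this
    rw [hsumm] at this
    rw [← this]
    exact Finset.sum_congr rfl fun i _ => by rw [hm']
  have hU₂ : ∑ i, lam i * h₂ (m' i).1 = ∑ u, Q u * h₂ (m u).1 := by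
    simpa only [Prod.snd_sum, Prod.fst_sum, Prod.smul_snd, Prod.smul_fst, G, smul_eq_mul] using
      congrArg (fun t => t.2.1) hG'
  have hU₃ : ∑ i, lam i * h₃ (m' i).1 = ∑ u, Q u * h₃ (m u).1 := by
    simpa only [Prod.snd_sum, Prod.fst_sum, Prod.smul_snd, Prod.smul_fst, G, smul_eq_mul] using
      congrArg (fun t => t.2.2) hG'
  have hfst : ∀ i, ∑ j, (lam i * mu i j) • q' i j = lam i • (m' i).1 := fun i => by
    have := congrArg Prod.fst (hm' i)
    simp only [Prod.fst_sum, Prod.smul_fst, F] at this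
    rw [← this, Finset.smul_sum]
    simp only [smul_smul]
  have hfstu : ∀ u, ∑ v, k v u • r v = Q u • (m u).1 := fun u => by
    have := congrArg Prod.fst (hm u)
    simp only [Prod.fst_sum, Prod.smul_fst, F] at this
    rw [← this]
    exact Finset.sum_congr rfl fun v _ => by rw [← hrq' v, smul_smul, mul_comm]
  refine ⟨fun i j => (lam i * mu i j) • q' i j, fun i j x => ?_, ?_, ?_, ?_, ?_, ?_, ?_⟩
  · exact mul_nonneg (mul_nonneg (hlam i) (hmu i j)) ((hq'Δ i j).1 x)
  · have := congrArg (fun t => t.1) hV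
    simp only [Prod.fst_sum, Prod.smul_fst, F, Finset.smul_sum, smul_smul] at this
    rw [this, ← hrp]
    exact Finset.sum_congr rfl fun v _ => hrq' v
  · have := congrArg (fun t => t.2.1) hV
    simp only [Prod.snd_sum, Prod.fst_sum, Prod.smul_snd, Prod.smul_fst, F, Finset.smul_sum,
      smul_smul] at this
    simpa only [hh₁, smul_eq_mul, ← hrq'] using this
  · have := congrArg (fun t => t.2.2.1) hV
    simp only [Prod.snd_sum, Prod.fst_sum, Prod.smul_snd, Prod.smul_fst, F, Finset.smul_sum,
      smul_smul] at this
    simpa only [hh₂, smul_eq_mul, ← hrq'] using this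
  · have := congrArg (fun t => t.2.2.2) hV
    simp only [Prod.snd_sum, Prod.smul_snd, F, Finset.smul_sum, smul_smul] at this
    simpa only [hh₃, smul_eq_mul, ← hrq'] using this
  · simpa only [hfst, hfstu, hh₂] using hU₂
  · simpa only [hfst, hfstu, hh₃] using hU₃

section Entropy

/-- The summand `-t log₂ t` of Shannon entropy. -/
noncomputable def negMulLogb (t : ℝ) : ℝ := -(t * Real.logb 2 t)

lemma negMulLogb_eq (t : ℝ) : negMulLogb t = Real.negMulLog t / Real.log 2 := by
  simp only [negMulLogb, Real.negMulLog, Real.logb]; ring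

lemma negMulLogb_mul (x y : ℝ) :
    negMulLogb (x * y) = y * negMulLogb x + x * negMulLogb y := by
  simp only [negMulLogb_eq, Real.negMulLog_mul]; ring

lemma continuous_negMulLogb : Continuous negMulLogb := by
  rw [funext negMulLogb_eq]
  exact Real.continuous_negMulLog.div_const _

/-- Entropy of the output of the kernel `K` under the (unnormalised) input measure `r`, scaled so
as to be homogeneous of degree one in `r`. -/
noncomputable def kernelEnt {α β : Type*} [Fintype α] [Fintype β] (K : α → β → ℝ) (r : α → ℝ) : ℝ :=
  ∑ b, negMulLogb (∑ a, r a * K a b) - negMulLogb (∑ b, ∑ a, r a * K a b)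

lemma continuous_kernelEnt {α β : Type*} [Fintype α] [Fintype β] (K : α → β → ℝ) :
    Continuous (kernelEnt K) := by
  unfold kernelEnt
  have := continuous_negMulLogb
  fun_prop

lemma kernelEnt_smul {α β : Type*} [Fintype α] [Fintype β] (K : α → β → ℝ) (c : ℝ) (r : α → ℝ) :
    kernelEnt K (c • r) = c * kernelEnt K r := by
  simp only [kernelEnt, Pi.smul_apply, smul_eq_mul, mul_assoc, ← Finset.mul_sum, negMulLogb_mul,
    Finset.sum_add_distrib, ← Finset.sum_mul]
  ring

variable {Ω α β γ δ ξ τ : Type*} [Fintype Ω]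

lemma pmass_congr {μ : Ω → ℝ} {X : Ω → α} {Y : Ω → β} {a : α} {b : β}
    (h : ∀ ω, X ω = a ↔ Y ω = b) : pmass μ X a = pmass μ Y b := by
  classical exact Finset.sum_congr rfl fun ω _ => if_congr (h ω) rfl rfl

lemma sum_pmass_mul [Fintype α] (μ : Ω → ℝ) (X : Ω → α) (g : α → ℝ) :
    ∑ a, pmass μ X a * g a = ∑ ω, μ ω * g (X ω) := by
  classical
  simp only [pmass, Finset.sum_mul, ite_mul, zero_mul]
  rw [Finset.sum_comm]
  simp

lemma pmass_nonneg {μ : Ω → ℝ} (hμ : ∀ ω, 0 ≤ μ ω) (X : Ω → α) (a : α) : 0 ≤ pmass μ X a :=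
  Finset.sum_nonneg fun ω _ => by split_ifs; exacts [hμ ω, le_rfl]

lemma isPMF_pmass [Fintype α] {μ : Ω → ℝ} (hμ : IsPMF μ) (X : Ω → α) : IsPMF (pmass μ X) := by
  refine ⟨pmass_nonneg hμ.1 X, ?_⟩
  simpa [hμ.2] using sum_pmass_mul μ X fun _ => 1

lemma pmass_pmass [Fintype α] (μ : Ω → ℝ) (X : Ω → α) (g : α → β) :
    pmass (pmass μ X) g = pmass μ fun ω => g (X ω) := by
  classical
  ext b
  have := sum_pmass_mul μ X fun a => if g a = b then 1 else 0
  simpa [pmass] using this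

lemma ent_pmass [Fintype α] [Fintype β] (μ : Ω → ℝ) (X : Ω → α) (g : α → β) :
    ent (pmass μ X) g = ent μ fun ω => g (X ω) := by
  simp only [ent, pmass_pmass]

lemma ent_eq_sum [Fintype α] (μ : Ω → ℝ) (X : Ω → α) : ent μ X = ∑ x, negMulLogb (pmass μ X x) := rfl

lemma sum_pmass_prod_left [Fintype α] (μ : Ω → ℝ) (X : Ω → α) (Y : Ω → β) (b : β) :
    ∑ a, pmass μ (fun ω => (X ω, Y ω)) (a, b) = pmass μ Y b := by
  classical
  simp only [pmass, Prod.mk.injEq, ite_and]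
  rw [Finset.sum_comm]
  simp

lemma ent_comp_equiv [Fintype α] [Fintype β] (μ : Ω → ℝ) (X : Ω → α) (e : α ≃ β) :
    ent μ (fun ω => e (X ω)) = ent μ X := by
  have h : ∀ a, pmass μ (fun ω => e (X ω)) (e a) = pmass μ X a := fun a =>
    pmass_congr fun ω => e.injective.eq_iff
  simp only [ent, ← e.sum_comp, h]

/-- If `C` is the output of the channel `W` with input `κ S`, then the joint law of a function of
`S` and `C` factors through the input. -/
lemma pmass_channel [Fintype τ] [Fintype γ] {μ : Ω → ℝ} {S : Ω → τ} {C : Ω → γ} {κ : τ → ξ} {W : ξ → γ → ℝ}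
    (hJ : ∀ t c, pmass μ (fun ω => (S ω, C ω)) (t, c) = pmass μ S t * W (κ t) c)
    (D : τ → δ) (ρ : δ → ξ) (hρ : ∀ t, ρ (D t) = κ t) (d : δ) (c : γ) :
    pmass μ (fun ω => (D (S ω), C ω)) (d, c) = pmass μ (fun ω => D (S ω)) d * W (ρ d) c := by
  classical
  have h1 := congrFun (pmass_pmass μ (fun ω => (S ω, C ω)) fun tc => (D tc.1, tc.2)) (d, c)
  have h2 := congrFun (pmass_pmass μ S D) d
  rw [← h1, ← h2]
  simp only [pmass.eq_1 (pmass μ fun ω => (S ω, C ω)), pmass.eq_1 (pmass μ S),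
    Fintype.sum_prod_type, hJ, Prod.mk.injEq, ite_and, Finset.sum_mul, ite_mul, zero_mul]
  refine Finset.sum_congr rfl fun t _ => ?_
  split_ifs with h
  · simp [← h, hρ]
  · simp

lemma ent_channel [Fintype τ] [Fintype γ] [Fintype δ] {μ : Ω → ℝ} {S : Ω → τ} {C : Ω → γ} {κ : τ → ξ} {W : ξ → γ → ℝ}
    (hW : ∀ x, ∑ c, W x c = 1)
    (hJ : ∀ t c, pmass μ (fun ω => (S ω, C ω)) (t, c) = pmass μ S t * W (κ t) c)
    (D : τ → δ) (ρ : δ → ξ) (hρ : ∀ t, ρ (D t) = κ t) :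
    ent μ (fun ω => (D (S ω), C ω)) = ent μ (fun ω => D (S ω)) +
      ∑ ω, μ ω * ∑ c, negMulLogb (W (κ (S ω)) c) := by
  simp only [ent_eq_sum, Fintype.sum_prod_type, pmass_channel hJ D ρ hρ, negMulLogb_mul,
    Finset.sum_add_distrib, ← Finset.sum_mul, hW, one_mul, ← Finset.mul_sum]
  rw [sum_pmass_mul μ (fun ω => D (S ω)) fun d => ∑ c, negMulLogb (W (ρ d) c)]
  simp only [hρ]

/-- Conditional law of `T` given `κ` under the pmf `P`. -/
noncomputable def condKernel [Fintype τ] (P : τ → ℝ) (κ : τ → ξ) (T : τ → β) (x : ξ) (b : β) : ℝ :=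
  pmass P (fun t => (κ t, T t)) (x, b) / pmass P κ x

lemma mul_condKernel [Fintype τ] {P : τ → ℝ} (hP : ∀ t, 0 ≤ P t) (κ : τ → ξ) (T : τ → β) (x : ξ) (b : β) :
    pmass P κ x * condKernel P κ T x b = pmass P (fun t => (κ t, T t)) (x, b) := by
  classical
  by_cases h : pmass P κ x = 0
  · rw [h, zero_mul, eq_comm]
    refine le_antisymm ?_ (pmass_nonneg hP _ _)
    rw [← h]
    refine Finset.sum_le_sum fun t _ => ?_
    simp only [Prod.mk.injEq]
    split_ifs <;> simp_all
  · rw [condKernel, mul_div_cancel₀ _ h]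

lemma condEnt_channel [Fintype τ] [Fintype γ] [Fintype ξ] [Fintype β] {μ : Ω → ℝ} (hμ : ∀ ω, 0 ≤ μ ω) {S : Ω → τ} {C : Ω → γ} {κ : τ → ξ}
    {W : ξ → γ → ℝ}
    (hJ : ∀ t c, pmass μ (fun ω => (S ω, C ω)) (t, c) = pmass μ S t * W (κ t) c) (T : τ → β) :
    condEnt μ (fun ω => T (S ω)) C =
      ∑ c, kernelEnt (condKernel (pmass μ S) κ T) fun x => pmass (pmass μ S) κ x * W x c := by
  have key : ∀ b c, pmass μ (fun ω => (T (S ω), C ω)) (b, c) =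
      ∑ x, pmass (pmass μ S) κ x * W x c * condKernel (pmass μ S) κ T x b := by
    intro b c
    simp only [mul_right_comm _ (W _ c), mul_condKernel (pmass_nonneg hμ S)]
    rw [pmass_pmass μ S fun t => (κ t, T t)]
    rw [← sum_pmass_prod_left μ (fun ω => κ (S ω)) (fun ω => (T (S ω), C ω))]
    refine Finset.sum_congr rfl fun x _ => ?_
    rw [← pmass_channel hJ (fun t => (κ t, T t)) Prod.fst (fun _ => rfl) (x, b) c]
    exact pmass_congr fun ω => by simp only [Prod.mk.injEq, and_assoc]
  have hC : ∀ c, pmass μ C c = ∑ b, pmass μ (fun ω => (T (S ω), C ω)) (b, c) := fun c =>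
    (sum_pmass_prod_left μ _ C c).symm
  simp only [condEnt, ent_eq_sum, Fintype.sum_prod_type_right, kernelEnt, hC, key,
    Finset.sum_sub_distrib]

end Entropy

section Joint

lemma sum_channel_comp {𝒰 𝒱 𝒳 : Type*} [Fintype 𝒰] [Fintype 𝒱] {A : 𝒳 → 𝒱 → ℝ} {B : 𝒱 → 𝒰 → ℝ}
    (hA : ∀ x, IsPMF (A x)) (hB : ∀ v, IsPMF (B v)) (x : 𝒳) :
    ∑ u, ∑ v, A x v * B v u = 1 := by
  rw [Finset.sum_comm]
  simp only [← Finset.mul_sum, (hB _).2, mul_one, (hA _).2]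

variable {𝒰 𝒱 𝒳 𝒴 𝒵 : Type} [Fintype 𝒰] [Fintype 𝒱] [Fintype 𝒳] [Fintype 𝒴] [Fintype 𝒵]
  {P : 𝒳 × 𝒴 × 𝒵 → ℝ} {A : 𝒳 → 𝒱 → ℝ} {B : 𝒱 → 𝒰 → ℝ}

lemma mkJoint_nonneg (hP : IsPMF P) (hA : ∀ x, IsPMF (A x)) (hB : ∀ v, IsPMF (B v)) (ω) :
    0 ≤ mkJoint P A B ω :=
  mul_nonneg (mul_nonneg (hP.1 _) ((hA _).1 _)) ((hB _).1 _)

lemma pmass_mkJoint_source_fst_snd (t : 𝒳 × 𝒴 × 𝒵) (v : 𝒱) (u : 𝒰) :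
    pmass (mkJoint P A B) (fun ω => ((ω.2.2, ω.2.1), ω.1)) ((t, v), u) =
      P t * A t.1 v * B v u := by
  classical
  rw [pmass, Finset.sum_eq_single (u, v, t)]
  · simp [mkJoint]
  · rintro ⟨u', v', t'⟩ - h
    rw [if_neg]
    rintro h'
    simp only [Prod.mk.injEq] at h'
    simp_all
  · simp

lemma pmass_mkJoint_source_fst (hB : ∀ v, IsPMF (B v)) (t : 𝒳 × 𝒴 × 𝒵) (v : 𝒱) :
    pmass (mkJoint P A B) (fun ω => (ω.2.2, ω.2.1)) (t, v) = P t * A t.1 v := by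
  rw [← sum_pmass_prod_left _ (fun ω => ω.1)]
  have : ∀ u, pmass (mkJoint P A B) (fun ω => (ω.1, (ω.2.2, ω.2.1))) (u, (t, v)) =
      P t * A t.1 v * B v u := fun u => by
    rw [← pmass_mkJoint_source_fst_snd]
    exact pmass_congr fun ω => by simp only [Prod.mk.injEq, and_comm]
  simp only [this, ← Finset.mul_sum, (hB v).2, mul_one]

lemma pmass_mkJoint_source (hA : ∀ x, IsPMF (A x)) (hB : ∀ v, IsPMF (B v)) :
    pmass (mkJoint P A B) (fun ω => ω.2.2) = P := by
  ext t
  rw [← sum_pmass_prod_left _ (fun ω => ω.2.1)]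
  have : ∀ v, pmass (mkJoint P A B) (fun ω => (ω.2.1, ω.2.2)) (v, t) = P t * A t.1 v := fun v => by
    rw [← pmass_mkJoint_source_fst hB]
    exact pmass_congr fun ω => by simp only [Prod.mk.injEq, and_comm]
  simp only [this, ← Finset.mul_sum, (hA _).2, mul_one]

lemma pmass_mkJoint_source_snd (t : 𝒳 × 𝒴 × 𝒵) (u : 𝒰) :
    pmass (mkJoint P A B) (fun ω => (ω.2.2, ω.1)) (t, u) = P t * ∑ v, A t.1 v * B v u := by
  rw [← sum_pmass_prod_left _ (fun ω => ω.2.1), Finset.mul_sum]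
  refine Finset.sum_congr rfl fun v _ => ?_
  rw [← mul_assoc, ← pmass_mkJoint_source_fst_snd]
  exact pmass_congr fun ω => by simp only [Prod.mk.injEq, and_left_comm, and_assoc]

lemma channel_fst (hA : ∀ x, IsPMF (A x)) (hB : ∀ v, IsPMF (B v)) (t : 𝒳 × 𝒴 × 𝒵) (v : 𝒱) :
    pmass (mkJoint P A B) (fun ω => (ω.2.2, ω.2.1)) (t, v) =
      pmass (mkJoint P A B) (fun ω => ω.2.2) t * A t.1 v := by
  rw [pmass_mkJoint_source_fst hB, pmass_mkJoint_source hA hB]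

lemma channel_snd (hA : ∀ x, IsPMF (A x)) (hB : ∀ v, IsPMF (B v)) (t : 𝒳 × 𝒴 × 𝒵) (u : 𝒰) :
    pmass (mkJoint P A B) (fun ω => (ω.2.2, ω.1)) (t, u) =
      pmass (mkJoint P A B) (fun ω => ω.2.2) t * ∑ v, A t.1 v * B v u := by
  rw [pmass_mkJoint_source_snd, pmass_mkJoint_source hA hB]

lemma channel_fst_snd (hB : ∀ v, IsPMF (B v)) (t : (𝒳 × 𝒴 × 𝒵) × 𝒱) (u : 𝒰) :
    pmass (mkJoint P A B) (fun ω => ((ω.2.2, ω.2.1), ω.1)) (t, u) =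
      pmass (mkJoint P A B) (fun ω => (ω.2.2, ω.2.1)) t * B t.2 u := by
  obtain ⟨t, v⟩ := t
  rw [pmass_mkJoint_source_fst hB, pmass_mkJoint_source_fst_snd]

lemma ent_mkJoint_source (hA : ∀ x, IsPMF (A x)) (hB : ∀ v, IsPMF (B v)) {β : Type*} [Fintype β]
    (T : 𝒳 × 𝒴 × 𝒵 → β) : ent (mkJoint P A B) (fun ω => T ω.2.2) = ent P T := by
  have h := ent_pmass (mkJoint P A B) (fun ω => ω.2.2) T
  rw [pmass_mkJoint_source hA hB] at h
  exact h.symm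

lemma condEnt_mkJoint_fst (hP : IsPMF P) (hA : ∀ x, IsPMF (A x)) (hB : ∀ v, IsPMF (B v))
    {β : Type*} [Fintype β] (T : 𝒳 × 𝒴 × 𝒵 → β) :
    condEnt (mkJoint P A B) (fun ω => T ω.2.2) (fun ω => ω.2.1) =
      ∑ v, kernelEnt (condKernel P Prod.fst T) fun x => pmass P Prod.fst x * A x v := by
  rw [condEnt_channel (mkJoint_nonneg hP hA hB) (channel_fst hA hB), pmass_mkJoint_source hA hB]

lemma condEnt_mkJoint_snd (hP : IsPMF P) (hA : ∀ x, IsPMF (A x)) (hB : ∀ v, IsPMF (B v))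
    {β : Type*} [Fintype β] (T : 𝒳 × 𝒴 × 𝒵 → β) :
    condEnt (mkJoint P A B) (fun ω => T ω.2.2) (fun ω => ω.1) =
      ∑ u, kernelEnt (condKernel P Prod.fst T)
        (∑ v, B v u • fun x => pmass P Prod.fst x * A x v) := by
  rw [condEnt_channel (κ := Prod.fst) (W := fun x u => ∑ v, A x v * B v u)
    (mkJoint_nonneg hP hA hB) (channel_snd hA hB), pmass_mkJoint_source hA hB]
  refine Finset.sum_congr rfl fun u _ => congrArg _ ?_
  ext x
  simp only [Finset.sum_apply, Pi.smul_apply, smul_eq_mul, Finset.mul_sum]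
  exact Finset.sum_congr rfl fun v _ => by ring

lemma mutInf_mkJoint_Y_U (hA : ∀ x, IsPMF (A x)) (hB : ∀ v, IsPMF (B v)) :
    mutInf (mkJoint P A B) (fun ω => ω.2.2.2.1) (fun ω => ω.1) =
      ent P (fun t => t.2.1) -
        condEnt (mkJoint P A B) (fun ω => ω.2.2.2.1) (fun ω => ω.1) := by
  rw [mutInf, condEnt, ← ent_mkJoint_source hA hB (fun t => t.2.1)]
  ring

lemma condMutInf_mkJoint_X_V_Y (hA : ∀ x, IsPMF (A x)) (hB : ∀ v, IsPMF (B v)) :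
    condMutInf (mkJoint P A B) (fun ω => ω.2.2.1) (fun ω => ω.2.1) (fun ω => ω.2.2.2.1) =
      ent P (fun t => (t.1, t.2.1)) - ent P (fun t => t.2.1) +
        condEnt (mkJoint P A B) (fun ω => ω.2.2.2.1) (fun ω => ω.2.1) -
        condEnt (mkJoint P A B) (fun ω => (ω.2.2.1, ω.2.2.2.1)) (fun ω => ω.2.1) := by
  have e₁ := ent_comp_equiv (mkJoint P A B) (fun ω => (ω.2.2.2.1, ω.2.1)) (Equiv.prodComm 𝒴 𝒱)
  have e₂ := ent_comp_equiv (mkJoint P A B) (fun ω => ((ω.2.2.1, ω.2.2.2.1), ω.2.1))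
    ((Equiv.prodAssoc 𝒳 𝒴 𝒱).trans ((Equiv.refl 𝒳).prodCongr (Equiv.prodComm 𝒴 𝒱)))
  simp only [Equiv.prodComm_apply, Prod.swap_prod_mk, Equiv.trans_apply, Equiv.prodAssoc_apply,
    Equiv.prodCongr_apply, Prod.map_apply, Equiv.coe_refl, id_eq] at e₁ e₂
  rw [condMutInf, condEnt, condEnt, ← ent_mkJoint_source hA hB (fun t => t.2.1),
    ← ent_mkJoint_source hA hB (fun t => (t.1, t.2.1)), e₁, e₂]
  ring

lemma mutInf_mkJoint_X_VY (hA : ∀ x, IsPMF (A x)) (hB : ∀ v, IsPMF (B v)) :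
    mutInf (mkJoint P A B) (fun ω => ω.2.2.1) (fun ω => (ω.2.1, ω.2.2.2.1)) =
      ent P (fun t => t.1) +
        condEnt (mkJoint P A B) (fun ω => ω.2.2.2.1) (fun ω => ω.2.1) -
        condEnt (mkJoint P A B) (fun ω => (ω.2.2.1, ω.2.2.2.1)) (fun ω => ω.2.1) := by
  have h := condMutInf_mkJoint_X_V_Y (P := P) hA hB
  rw [condMutInf] at h
  rw [mutInf, ← ent_mkJoint_source hA hB (fun t => t.1)]
  rw [← ent_mkJoint_source hA hB (fun t => t.2.1),
    ← ent_mkJoint_source hA hB (fun t => (t.1, t.2.1))] at h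
  linarith

/-- For `T` a function of the source, `I(X; T | U)` in terms of `H(T | U)` and the source law. -/
lemma condMutInf_mkJoint_X_source_U (hA : ∀ x, IsPMF (A x)) (hB : ∀ v, IsPMF (B v))
    {β : Type*} [Fintype β] (T : 𝒳 × 𝒴 × 𝒵 → β) :
    condMutInf (mkJoint P A B) (fun ω => ω.2.2.1) (fun ω => T ω.2.2) (fun ω => ω.1) =
      condEnt (mkJoint P A B) (fun ω => T ω.2.2) (fun ω => ω.1) -
        (ent P (fun t => (t.1, T t)) - ent P (fun t => t.1)) := by
  have h₁ := ent_channel (sum_channel_comp hA hB) (channel_snd (P := P) hA hB)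
    (fun t => (t.1, T t)) Prod.fst (fun _ => rfl)
  have h₂ := ent_channel (sum_channel_comp hA hB) (channel_snd (P := P) hA hB)
    (fun t => t.1) id (fun _ => rfl)
  have e := ent_comp_equiv (mkJoint P A B) (fun ω => ((ω.2.2.1, T ω.2.2), ω.1))
    (Equiv.prodAssoc 𝒳 β 𝒰)
  simp only [Equiv.prodAssoc_apply] at e
  rw [ent_mkJoint_source hA hB (fun t => (t.1, T t))] at h₁
  rw [ent_mkJoint_source hA hB (fun t => t.1)] at h₂
  rw [condMutInf, condEnt, e]
  linarith

/-- For `T` a function of the source, `I(V; T | U) = H(T | U) - H(T | V)`. -/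
lemma condMutInf_mkJoint_V_source_U (hB : ∀ v, IsPMF (B v))
    {β : Type*} [Fintype β] (T : 𝒳 × 𝒴 × 𝒵 → β) :
    condMutInf (mkJoint P A B) (fun ω => ω.2.1) (fun ω => T ω.2.2) (fun ω => ω.1) =
      condEnt (mkJoint P A B) (fun ω => T ω.2.2) (fun ω => ω.1) -
        condEnt (mkJoint P A B) (fun ω => T ω.2.2) (fun ω => ω.2.1) := by
  have h₁ := ent_channel (fun v => (hB v).2) (channel_fst_snd (P := P) (A := A) hB)
    (fun t => (T t.1, t.2)) Prod.snd (fun _ => rfl)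
  have h₂ := ent_channel (fun v => (hB v).2) (channel_fst_snd (P := P) (A := A) hB)
    (fun t => t.2) id (fun _ => rfl)
  have e := ent_comp_equiv (mkJoint P A B) (fun ω => ((T ω.2.2, ω.2.1), ω.1))
    (((Equiv.prodComm β 𝒱).prodCongr (Equiv.refl 𝒰)).trans (Equiv.prodAssoc 𝒱 β 𝒰))
  simp only [Equiv.prodComm_apply, Prod.swap_prod_mk, Equiv.trans_apply, Equiv.prodAssoc_apply,
    Equiv.prodCongr_apply, Prod.map_apply, Equiv.coe_refl, id_eq] at e
  rw [condMutInf, condEnt, condEnt, e]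
  linarith

end Joint

/-- **Cardinality reduction (Appendix C).**  Given `(U,V,X,Y,Z)` with joint law
`P_{X,Y,Z} P_{V|X} P_{U|V}`, there exist `U'`, `V'` on alphabets of sizes at most
`|𝒳|+4` and `(|𝒳|+4)(|𝒳|+2)`, again with a joint law of the form
`P_{X,Y,Z} P_{V'|X} P_{U'|V'}` (in particular `U' − V' − X − (Y,Z)` is a Markov chain
and the law of `(X,Y,Z)` is unchanged), preserving `H(X,Y|V)`, `H(Y|V)`, `H(Z|V)`,
`H(Y|U)`, `H(Z|U)`; consequently `I(Y;U)`, `I(X;V|Y)`,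
`I(X;V,Y) − I(X;Y|U) + I(X;Z|U)` and `I(V;Y|U) − I(V;Z|U)` are preserved. -/
theorem cardinality_reduction
    {𝒰 𝒱 𝒳 𝒴 𝒵 : Type} [Fintype 𝒰] [Fintype 𝒱] [Fintype 𝒳] [Fintype 𝒴] [Fintype 𝒵]
    (PXYZ : 𝒳 × 𝒴 × 𝒵 → ℝ) (hPXYZ : IsPMF PXYZ)
    (PVX : 𝒳 → 𝒱 → ℝ) (hPVX : ∀ x, IsPMF (PVX x))
    (PUV : 𝒱 → 𝒰 → ℝ) (hPUV : ∀ v, IsPMF (PUV v)) :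
    ∃ (nU nV : ℕ), nU ≤ Fintype.card 𝒳 + 4 ∧
      nV ≤ (Fintype.card 𝒳 + 4) * (Fintype.card 𝒳 + 2) ∧
      ∃ (PVX' : 𝒳 → Fin nV → ℝ) (PUV' : Fin nV → Fin nU → ℝ),
        (∀ x, IsPMF (PVX' x)) ∧ (∀ v, IsPMF (PUV' v)) ∧
        -- the marginal law of (X,Y,Z) is unchanged
        (∀ t : 𝒳 × 𝒴 × 𝒵,
          pmass (mkJoint PXYZ PVX' PUV') (fun ω => (ω.2.2.1, ω.2.2.2.1, ω.2.2.2.2)) t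
            = pmass (mkJoint PXYZ PVX PUV) (fun ω => (ω.2.2.1, ω.2.2.2.1, ω.2.2.2.2)) t) ∧
        -- H(X,Y|V') = H(X,Y|V)
        condEnt (mkJoint PXYZ PVX' PUV') (fun ω => (ω.2.2.1, ω.2.2.2.1)) (fun ω => ω.2.1)
          = condEnt (mkJoint PXYZ PVX PUV) (fun ω => (ω.2.2.1, ω.2.2.2.1)) (fun ω => ω.2.1) ∧
        -- H(Y|V') = H(Y|V)
        condEnt (mkJoint PXYZ PVX' PUV') (fun ω => ω.2.2.2.1) (fun ω => ω.2.1)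
          = condEnt (mkJoint PXYZ PVX PUV) (fun ω => ω.2.2.2.1) (fun ω => ω.2.1) ∧
        -- H(Z|V') = H(Z|V)
        condEnt (mkJoint PXYZ PVX' PUV') (fun ω => ω.2.2.2.2) (fun ω => ω.2.1)
          = condEnt (mkJoint PXYZ PVX PUV) (fun ω => ω.2.2.2.2) (fun ω => ω.2.1) ∧
        -- H(Y|U') = H(Y|U)
        condEnt (mkJoint PXYZ PVX' PUV') (fun ω => ω.2.2.2.1) (fun ω => ω.1)
          = condEnt (mkJoint PXYZ PVX PUV) (fun ω => ω.2.2.2.1) (fun ω => ω.1) ∧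
        -- H(Z|U') = H(Z|U)
        condEnt (mkJoint PXYZ PVX' PUV') (fun ω => ω.2.2.2.2) (fun ω => ω.1)
          = condEnt (mkJoint PXYZ PVX PUV) (fun ω => ω.2.2.2.2) (fun ω => ω.1) ∧
        -- I(Y;U') = I(Y;U)
        mutInf (mkJoint PXYZ PVX' PUV') (fun ω => ω.2.2.2.1) (fun ω => ω.1)
          = mutInf (mkJoint PXYZ PVX PUV) (fun ω => ω.2.2.2.1) (fun ω => ω.1) ∧
        -- I(X;V'|Y) = I(X;V|Y)
        condMutInf (mkJoint PXYZ PVX' PUV') (fun ω => ω.2.2.1) (fun ω => ω.2.1)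
            (fun ω => ω.2.2.2.1)
          = condMutInf (mkJoint PXYZ PVX PUV) (fun ω => ω.2.2.1) (fun ω => ω.2.1)
            (fun ω => ω.2.2.2.1) ∧
        -- I(X;V',Y) − I(X;Y|U') + I(X;Z|U') = I(X;V,Y) − I(X;Y|U) + I(X;Z|U)
        (mutInf (mkJoint PXYZ PVX' PUV') (fun ω => ω.2.2.1) (fun ω => (ω.2.1, ω.2.2.2.1))
          - condMutInf (mkJoint PXYZ PVX' PUV') (fun ω => ω.2.2.1) (fun ω => ω.2.2.2.1)
            (fun ω => ω.1)
          + condMutInf (mkJoint PXYZ PVX' PUV') (fun ω => ω.2.2.1) (fun ω => ω.2.2.2.2)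
            (fun ω => ω.1))
          = (mutInf (mkJoint PXYZ PVX PUV) (fun ω => ω.2.2.1) (fun ω => (ω.2.1, ω.2.2.2.1))
          - condMutInf (mkJoint PXYZ PVX PUV) (fun ω => ω.2.2.1) (fun ω => ω.2.2.2.1)
            (fun ω => ω.1)
          + condMutInf (mkJoint PXYZ PVX PUV) (fun ω => ω.2.2.1) (fun ω => ω.2.2.2.2)
            (fun ω => ω.1)) ∧
        -- I(V';Y|U') − I(V';Z|U') = I(V;Y|U) − I(V;Z|U)
        (condMutInf (mkJoint PXYZ PVX' PUV') (fun ω => ω.2.1) (fun ω => ω.2.2.2.1)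
            (fun ω => ω.1)
          - condMutInf (mkJoint PXYZ PVX' PUV') (fun ω => ω.2.1) (fun ω => ω.2.2.2.2)
            (fun ω => ω.1))
          = (condMutInf (mkJoint PXYZ PVX PUV) (fun ω => ω.2.1) (fun ω => ω.2.2.2.1)
            (fun ω => ω.1)
          - condMutInf (mkJoint PXYZ PVX PUV) (fun ω => ω.2.1) (fun ω => ω.2.2.2.2)
            (fun ω => ω.1)) := by
  classical
  let p := pmass PXYZ Prod.fst
  have hp : IsPMF p := isPMF_pmass hPXYZ _
  let h₁ := kernelEnt (condKernel PXYZ Prod.fst fun t => (t.1, t.2.1))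
  let h₂ := kernelEnt (condKernel PXYZ Prod.fst fun t => t.2.1)
  let h₃ := kernelEnt (condKernel PXYZ Prod.fst fun t => t.2.2)
  obtain ⟨r, hr, hrp, hr₁, hr₂, hr₃, hrU₂, hrU₃⟩ := exists_support_reduction h₁ h₂ h₃
    (continuous_kernelEnt _) (continuous_kernelEnt _) (continuous_kernelEnt _)
    (kernelEnt_smul _) (kernelEnt_smul _) (kernelEnt_smul _)
    (fun v x => p x * PVX x v) (fun v x => mul_nonneg (hp.1 x) ((hPVX x).1 v)) p hp
    (by ext x; simp [Finset.sum_apply, ← Finset.mul_sum, (hPVX x).2]) PUV hPUV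
  have hrp' : ∀ x, ∑ i, ∑ j, r i j x = p x := fun x => by
    rw [← hrp]; simp [Finset.sum_apply]
  let A : 𝒳 → Fin ((Fintype.card 𝒳 + 4) * (Fintype.card 𝒳 + 2)) → ℝ := fun x k =>
    if p x = 0 then if finProdFinEquiv.symm k = (0, 0) then 1 else 0
    else r (finProdFinEquiv.symm k).1 (finProdFinEquiv.symm k).2 x / p x
  let B : Fin ((Fintype.card 𝒳 + 4) * (Fintype.card 𝒳 + 2)) → Fin (Fintype.card 𝒳 + 4) → ℝ :=
    fun k i => if (finProdFinEquiv.symm k).1 = i then 1 else 0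
  have hA : ∀ x, IsPMF (A x) := by
    refine fun x => ⟨fun k => ?_, ?_⟩
    · simp only [A]
      split_ifs
      exacts [zero_le_one, le_rfl, div_nonneg (hr _ _ _) (hp.1 x)]
    · rw [← finProdFinEquiv.sum_comp]
      simp only [A, Equiv.symm_apply_apply]
      by_cases hx : p x = 0
      · simp [hx]
      · simp only [hx, if_false, Fintype.sum_prod_type, ← Finset.sum_div, hrp' x]
        exact div_self hx
  have hB : ∀ k, IsPMF (B k) := by
    refine fun k => ⟨fun i => ?_, by simp [B]⟩
    simp only [B]
    split_ifs
    exacts [zero_le_one, le_rfl]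
  have hAr : ∀ i j, (fun x => p x * A x (finProdFinEquiv (i, j))) = r i j := by
    intro i j
    ext x
    simp only [A, Equiv.symm_apply_apply]
    by_cases hx : p x = 0
    · have h := hrp' x
      rw [hx, Finset.sum_eq_zero_iff_of_nonneg
        fun i _ => Finset.sum_nonneg fun j _ => hr i j x] at h
      have h' := h i (Finset.mem_univ i)
      rw [Finset.sum_eq_zero_iff_of_nonneg fun j _ => hr i j x] at h'
      rw [hx, zero_mul, h' j (Finset.mem_univ j)]
    · rw [if_neg hx, mul_div_cancel₀ _ hx]
  have hV : ∀ h : (𝒳 → ℝ) → ℝ, ∑ k, h (fun x => p x * A x k) = ∑ i, ∑ j, h (r i j) := by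
    intro h
    rw [← finProdFinEquiv.sum_comp]
    simp only [Fintype.sum_prod_type, hAr]
  have hU : ∀ i, ∑ k, B k i • (fun x => p x * A x k) = ∑ j, r i j := by
    intro i
    rw [← finProdFinEquiv.sum_comp]
    simp only [Fintype.sum_prod_type, hAr, B, Equiv.symm_apply_apply, ite_smul, one_smul, zero_smul]
    rw [Finset.sum_eq_single i (fun i' _ hi => by simp [hi]) (by simp)]
    simp
  have c₁ : condEnt (mkJoint PXYZ A B) (fun ω => (ω.2.2.1, ω.2.2.2.1)) (fun ω => ω.2.1) =
      condEnt (mkJoint PXYZ PVX PUV) (fun ω => (ω.2.2.1, ω.2.2.2.1)) (fun ω => ω.2.1) := by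
    rw [condEnt_mkJoint_fst hPXYZ hA hB fun t => (t.1, t.2.1),
      condEnt_mkJoint_fst hPXYZ hPVX hPUV fun t => (t.1, t.2.1)]
    exact (hV h₁).trans hr₁
  have c₂ : condEnt (mkJoint PXYZ A B) (fun ω => ω.2.2.2.1) (fun ω => ω.2.1) =
      condEnt (mkJoint PXYZ PVX PUV) (fun ω => ω.2.2.2.1) (fun ω => ω.2.1) := by
    rw [condEnt_mkJoint_fst hPXYZ hA hB fun t => t.2.1,
      condEnt_mkJoint_fst hPXYZ hPVX hPUV fun t => t.2.1]
    exact (hV h₂).trans hr₂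
  have c₃ : condEnt (mkJoint PXYZ A B) (fun ω => ω.2.2.2.2) (fun ω => ω.2.1) =
      condEnt (mkJoint PXYZ PVX PUV) (fun ω => ω.2.2.2.2) (fun ω => ω.2.1) := by
    rw [condEnt_mkJoint_fst hPXYZ hA hB fun t => t.2.2,
      condEnt_mkJoint_fst hPXYZ hPVX hPUV fun t => t.2.2]
    exact (hV h₃).trans hr₃
  have c₄ : condEnt (mkJoint PXYZ A B) (fun ω => ω.2.2.2.1) (fun ω => ω.1) =
      condEnt (mkJoint PXYZ PVX PUV) (fun ω => ω.2.2.2.1) (fun ω => ω.1) := by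
    rw [condEnt_mkJoint_snd hPXYZ hA hB fun t => t.2.1,
      condEnt_mkJoint_snd hPXYZ hPVX hPUV fun t => t.2.1]
    exact (Finset.sum_congr rfl fun i _ => congrArg h₂ (hU i)).trans hrU₂
  have c₅ : condEnt (mkJoint PXYZ A B) (fun ω => ω.2.2.2.2) (fun ω => ω.1) =
      condEnt (mkJoint PXYZ PVX PUV) (fun ω => ω.2.2.2.2) (fun ω => ω.1) := by
    rw [condEnt_mkJoint_snd hPXYZ hA hB fun t => t.2.2,
      condEnt_mkJoint_snd hPXYZ hPVX hPUV fun t => t.2.2]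
    exact (Finset.sum_congr rfl fun i _ => congrArg h₃ (hU i)).trans hrU₃
  refine ⟨_, _, le_rfl, le_rfl, A, B, hA, hB, fun t => ?_, c₁, c₂, c₃, c₄, c₅, ?_, ?_, ?_, ?_⟩
  · exact congrFun ((pmass_mkJoint_source hA hB).trans (pmass_mkJoint_source hPVX hPUV).symm) t
  · rw [mutInf_mkJoint_Y_U hA hB, mutInf_mkJoint_Y_U hPVX hPUV, c₄]
  · rw [condMutInf_mkJoint_X_V_Y hA hB, condMutInf_mkJoint_X_V_Y hPVX hPUV, c₁, c₂]
  · rw [mutInf_mkJoint_X_VY hA hB, mutInf_mkJoint_X_VY hPVX hPUV,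
      condMutInf_mkJoint_X_source_U hA hB fun t => t.2.1,
      condMutInf_mkJoint_X_source_U hA hB fun t => t.2.2,
      condMutInf_mkJoint_X_source_U hPVX hPUV fun t => t.2.1,
      condMutInf_mkJoint_X_source_U hPVX hPUV fun t => t.2.2, c₁, c₂, c₄, c₅]
  · rw [condMutInf_mkJoint_V_source_U hB fun t => t.2.1,
      condMutInf_mkJoint_V_source_U hB fun t => t.2.2,
      condMutInf_mkJoint_V_source_U hPUV fun t => t.2.1,
      condMutInf_mkJoint_V_source_U hPUV fun t => t.2.2, c₂, c₃, c₄, c₅]
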